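/- arXiv:2302.07470 — 10 statements merged into one kernel-verified Lean document; each statement's English description precedes it below -/
import Mathlib

section
/- Let ν be a Borel probability measure on [0,∞), let F : [0,∞) → [0,∞) be Borel measurable with L := ∫₀^∞ F(r) dν(r) ∈ (0,∞), and let K > 0. Then for every x > 0 and all a, a' with LK/(1+L) ≤ a ≤ a' ≤ min(x, K), one has (K−a')·∫₀^∞ (a'/x)^{F(r)} dν(r) ≤ (K−a)·∫₀^∞ (a/x)^{F(r)} dν(r). That is, the map a ↦ (K−a)·∫₀^∞ (a/x)^{F(r)} dν(r) is non-increasing on [LK/(1+L), min(x,K)]. -/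
open MeasureTheory

/-- If `b ≤ 1`, then `f` and `b ^ f` are oppositely monotone: a Chebyshev-type pointwise bound. -/
lemma sub_mul_rpow_le {b : ℝ} (hb : 0 < b) (hb1 : b ≤ 1) (f L : ℝ) :
    (f - L) * b ^ f ≤ (f - L) * b ^ L := by
  rcases le_total f L with h | h
  · exact mul_le_mul_of_nonpos_left (Real.rpow_le_rpow_of_exponent_ge hb hb1 h) (by linarith)
  · exact mul_le_mul_of_nonneg_left (Real.rpow_le_rpow_of_exponent_ge hb hb1 h) (by linarith)

lemma rpow_mul_add_le_mul_rpow {s b : ℝ} (hs : 0 < s) (hs1 : s ≤ 1) (hb : 0 < b) (hb1 : b ≤ 1)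
    (f L : ℝ) :
    s ^ L * (b ^ f + Real.log s * b ^ L * (f - L)) ≤ (s * b) ^ f := by
  have htangent : 1 + Real.log s * (f - L) ≤ s ^ (f - L) := by
    rw [Real.rpow_def_of_pos hs, add_comm]
    exact Real.add_one_le_exp _
  have hcheb := mul_le_mul_of_nonpos_left (sub_mul_rpow_le hb hb1 f L)
    (Real.log_nonpos hs.le hs1)
  have hbf := Real.rpow_pos_of_pos hb f
  have hsplit : (s * b) ^ f = s ^ L * (b ^ f * s ^ (f - L)) := by
    rw [Real.mul_rpow hs.le hb.le, Real.rpow_sub hs]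
    field_simp [(Real.rpow_pos_of_pos hs L).ne']
  rw [hsplit]
  refine mul_le_mul_of_nonneg_left ?_ (Real.rpow_nonneg hs.le L)
  nlinarith [mul_le_mul_of_nonneg_left htangent hbf.le]

lemma integrable_rpow_of_le_one {α : Type*} [MeasurableSpace α] {ν : Measure α}
    [IsFiniteMeasure ν] {F : α → ℝ} (hF : Measurable F) (hF0 : ∀ r, 0 ≤ F r)
    {b : ℝ} (hb : 0 < b) (hb1 : b ≤ 1) : Integrable (fun r => b ^ F r) ν := by
  refine Integrable.of_bound (measurable_const.pow hF).aestronglyMeasurable 1 (ae_of_all _ ?_)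
  intro r
  rw [Real.norm_of_nonneg (Real.rpow_nonneg hb.le _)]
  exact Real.rpow_le_one hb.le hb1 (hF0 r)

lemma rpow_integral_mul_integral_rpow_le {α : Type*} [MeasurableSpace α] {ν : Measure α}
    [IsProbabilityMeasure ν] {F : α → ℝ} (hF : Measurable F) (hF0 : ∀ r, 0 ≤ F r)
    (hFint : Integrable F ν) {s b : ℝ} (hs : 0 < s) (hs1 : s ≤ 1) (hb : 0 < b) (hb1 : b ≤ 1) :
    s ^ (∫ r, F r ∂ν) * ∫ r, b ^ F r ∂ν ≤ ∫ r, (s * b) ^ F r ∂ν := by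
  set L := ∫ r, F r ∂ν with hL
  have hi := integrable_rpow_of_le_one (ν := ν) hF hF0 hb hb1
  have hd : Integrable (fun r => Real.log s * b ^ L * (F r - L)) ν :=
    (hFint.sub (integrable_const L)).const_mul _
  have hzero : ∫ r, Real.log s * b ^ L * (F r - L) ∂ν = 0 := by
    rw [integral_const_mul, integral_sub hFint (integrable_const L), ← hL]
    simp
  calc s ^ L * ∫ r, b ^ F r ∂ν
      = ∫ r, s ^ L * (b ^ F r + Real.log s * b ^ L * (F r - L)) ∂ν := by
        rw [integral_const_mul, integral_add hi hd, hzero, add_zero]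
    _ ≤ ∫ r, (s * b) ^ F r ∂ν :=
        integral_mono ((hi.add hd).const_mul _)
          (integrable_rpow_of_le_one hF hF0 (mul_pos hs hb) (mul_le_one₀ hs1 hb.le hb1))
          fun r => rpow_mul_add_le_mul_rpow hs hs1 hb hb1 (F r) L

/-- The map `a ↦ (K - a) * a ^ L` decreases on `[L * K / (1 + L), K]`. -/
lemma sub_le_sub_mul_div_rpow {K L a a' : ℝ} (hL : 0 < L) (ha : 0 < a)
    (hLa : L * K ≤ a * (1 + L)) (haa' : a ≤ a') (ha'K : a' ≤ K) :
    K - a' ≤ (K - a) * (a / a') ^ L := by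
  have ha' : 0 < a' := ha.trans_le haa'
  rcases (haa'.trans ha'K).eq_or_lt with h | h
  · rw [h, sub_self, zero_mul]
    linarith
  have hKa : 0 < K - a := sub_pos.mpr h
  have hlog : 1 - a' / a ≤ Real.log (a / a') := by
    simpa using Real.one_sub_inv_le_log_of_pos (div_pos ha ha')
  have hexp : 1 - (a' - a) / (K - a) ≤ (a / a') ^ L := by
    have hslope : L * (a' - a) / a ≤ (a' - a) / (K - a) := by
      rw [div_le_div_iff₀ ha hKa]
      nlinarith [mul_nonneg (sub_nonneg.mpr haa') (sub_nonneg.mpr hLa)]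
    have hmul : L * (1 - a' / a) = -(L * (a' - a) / a) := by
      field_simp
      ring
    rw [Real.rpow_def_of_pos (div_pos ha ha')]
    linarith [Real.add_one_le_exp (Real.log (a / a') * L), mul_le_mul_of_nonneg_left hlog hL.le]
  calc K - a' = (K - a) * (1 - (a' - a) / (K - a)) := by
        field_simp
        ring
    _ ≤ _ := mul_le_mul_of_nonneg_left hexp hKa.le

theorem stmt_4 (ν : Measure ℝ) [IsProbabilityMeasure ν] (hν : ν (Set.Iio 0) = 0)
    (F : ℝ → ℝ) (hFmeas : Measurable F) (hFnonneg : ∀ r, 0 ≤ F r)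
    (hFint : Integrable F ν)
    (L : ℝ) (hL : L = ∫ r, F r ∂ν) (hLpos : 0 < L)
    (K : ℝ) (hK : 0 < K) :
    ∀ x > (0:ℝ), ∀ a a', L * K / (1 + L) ≤ a → a ≤ a' → a' ≤ min x K →
      (K - a') * ∫ r, (a' / x) ^ F r ∂ν ≤ (K - a) * ∫ r, (a / x) ^ F r ∂ν := by
  intro x hx a a' hLa haa' ha'
  obtain ⟨ha'x, ha'K⟩ := le_min_iff.mp ha'
  have ha : 0 < a := lt_of_lt_of_le (by positivity) hLa
  have ha'pos : 0 < a' := ha.trans_le haa'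
  rw [div_le_iff₀ (by positivity)] at hLa
  have hprod : a / a' * (a' / x) = a / x := by field_simp
  have hint := rpow_integral_mul_integral_rpow_le hFmeas hFnonneg hFint (div_pos ha ha'pos)
    ((div_le_one ha'pos).mpr haa') (div_pos ha'pos hx) ((div_le_one hx).mpr ha'x)
  rw [← hL, hprod] at hint
  calc (K - a') * ∫ r, (a' / x) ^ F r ∂ν
      ≤ (K - a) * (a / a') ^ L * ∫ r, (a' / x) ^ F r ∂ν :=
        mul_le_mul_of_nonneg_right (sub_le_sub_mul_div_rpow hLpos ha hLa haa' ha'K)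
          (integral_nonneg fun r => Real.rpow_nonneg (div_pos ha'pos hx).le _)
    _ ≤ (K - a) * ∫ r, (a / x) ^ F r ∂ν := by
        rw [mul_assoc]
        exact mul_le_mul_of_nonneg_left hint (by linarith)
end

section
/- Let K > 0, β > 0 and a ∈ (0,K). Then the inequality (K−a)·(a/x)^β ≥ K−x holds for all x ≥ a if and only if a ≥ βK/(1+β). -/
theorem one_sub_mul_le_inv_rpow {a x β : ℝ} (ha : 0 < a) (hx : 0 < x) (hβ : 0 ≤ β) :
    1 - β * (x / a - 1) ≤ (a / x) ^ β := by
  have hlog : Real.log (x / a) ≤ x / a - 1 := Real.log_le_sub_one_of_pos (by positivity)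
  have hinv : Real.log (a / x) = -Real.log (x / a) := by rw [← Real.log_inv, inv_div]
  rw [Real.rpow_def_of_pos (by positivity), hinv]
  have := Real.add_one_le_exp (-Real.log (x / a) * β)
  nlinarith [mul_le_mul_of_nonneg_left hlog hβ]

theorem rpow_mul_one_add_mul_le_one {a x β : ℝ} (ha : 0 < a) (hx : 0 < x) (hβ : 0 ≤ β) :
    (a / x) ^ β * (1 + β * (1 - a / x)) ≤ 1 := by
  have h := one_sub_mul_le_inv_rpow hx ha hβ
  have hp : 0 < (a / x) ^ β := by positivity
  calc (a / x) ^ β * (1 + β * (1 - a / x)) ≤ (a / x) ^ β * (x / a) ^ β :=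
        mul_le_mul_of_nonneg_left (by linarith) hp.le
    _ = 1 := by
        rw [← Real.mul_rpow (by positivity) (by positivity), div_mul_div_cancel₀ hx.ne',
          div_self ha.ne', Real.one_rpow]

theorem stmt_5 (K β : ℝ) (hK : 0 < K) (hβ : 0 < β) (a : ℝ) (ha : a ∈ Set.Ioo 0 K) :
    (∀ x ≥ a, (K - a) * (a / x) ^ β ≥ K - x) ↔ β * K / (1 + β) ≤ a := by
  obtain ⟨ha0, haK⟩ := ha
  constructor
  · intro h
    refine le_of_forall_gt_imp_ge_of_dense fun x hax => ?_
    have hx : 0 < x := ha0.trans hax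
    have hq : a / x < 1 := (div_lt_one hx).2 hax
    have hc : 0 ≤ 1 + β * (1 - a / x) := by nlinarith
    have h1 : (K - x) * (1 + β * (1 - a / x)) ≤ K - a :=
      calc (K - x) * (1 + β * (1 - a / x))
          ≤ (K - a) * (a / x) ^ β * (1 + β * (1 - a / x)) :=
            mul_le_mul_of_nonneg_right (h x hax.le) hc
        _ = (K - a) * ((a / x) ^ β * (1 + β * (1 - a / x))) := by ring
        _ ≤ (K - a) * 1 :=
            mul_le_mul_of_nonneg_left (rpow_mul_one_add_mul_le_one ha0 hx hβ.le) (by linarith)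
        _ = K - a := mul_one _
    have h2 : x * (1 - a / x) = x - a := by field_simp
    have h3 : (K - x) * β * (1 - a / x) ≤ x * (1 - a / x) := by linarith
    have h4 := le_of_mul_le_mul_right h3 (by linarith)
    rw [div_le_iff₀ (by linarith)]
    linarith
  · intro h x hx
    rw [div_le_iff₀ (by linarith)] at h
    have hx0 : 0 < x := ha0.trans_le hx
    have ht : 0 ≤ x / a - 1 := sub_nonneg.2 ((one_le_div ha0).2 hx)
    have h1 := mul_le_mul_of_nonneg_left (one_sub_mul_le_inv_rpow ha0 hx0 hβ.le)
      (by linarith : 0 ≤ K - a)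
    have h2 : a * (x / a - 1) = x - a := by field_simp
    have h3 : (K - a) * β * (x / a - 1) ≤ a * (x / a - 1) :=
      mul_le_mul_of_nonneg_right (by linarith) ht
    linarith
end

section
/- Let b > 0 and a ∈ (0,1). The following are equivalent: (i) (1−a)·(a/x)·e^{−b(x−a)} ≥ 1−x for all x ≥ a; (ii) −b a² + (b−2)a + 1 ≤ 0; (iii) a ≥ √(1/4 + 1/b²) − 1/b + 1/2. -/
/-- The quadratic `-b x² + (b - 2) x + 1`, which is positive at `0`, stays nonpositive to the right
of any positive point where it is nonpositive. -/
theorem quadratic_nonpos_of_le {a b x : ℝ} (hb : 0 < b) (ha : 0 < a) (hax : a ≤ x)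
    (h : -b * a ^ 2 + (b - 2) * a + 1 ≤ 0) : -b * x ^ 2 + (b - 2) * x + 1 ≤ 0 := by
  have h1 : b * (1 - a) - 2 ≤ 0 := by
    by_contra! h2
    nlinarith [mul_pos ha h2]
  nlinarith [mul_nonneg (sub_nonneg.2 hax) (by nlinarith : 0 ≤ b * (x + a) - b + 2)]

theorem antitoneOn_mul_exp {a b : ℝ} (hb : 0 < b) (ha : 0 < a)
    (h : -b * a ^ 2 + (b - 2) * a + 1 ≤ 0) :
    AntitoneOn (fun x : ℝ => x * (1 - x) * Real.exp (b * (x - a))) (Set.Ici a) := by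
  have hd (x : ℝ) : HasDerivAt (fun x : ℝ => x * (1 - x) * Real.exp (b * (x - a)))
      ((-b * x ^ 2 + (b - 2) * x + 1) * Real.exp (b * (x - a))) x := by
    have h1 : HasDerivAt (fun x : ℝ => b * (x - a)) (b * 1) x :=
      ((hasDerivAt_id x).sub_const a).const_mul b
    have h2 : HasDerivAt (fun x : ℝ => x * (1 - x)) (1 * (1 - x) + x * (-1)) x :=
      (hasDerivAt_id x).mul ((hasDerivAt_id x).const_sub 1)
    exact (h2.mul h1.exp).congr_deriv (by ring)
  refine antitoneOn_of_hasDerivWithinAt_nonpos (convex_Ici a)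
    (fun x _ => (hd x).continuousAt.continuousWithinAt) (fun x _ => (hd x).hasDerivWithinAt) ?_
  intro x hx
  rw [interior_Ici] at hx
  exact mul_nonpos_of_nonpos_of_nonneg (quadratic_nonpos_of_le hb ha (le_of_lt hx) h)
    (Real.exp_pos _).le

theorem payoff_le_iff {a b x : ℝ} (hx : 0 < x) :
    1 - x ≤ (1 - a) * (a / x) * Real.exp (-b * (x - a)) ↔
      x * (1 - x) * Real.exp (b * (x - a)) ≤ a * (1 - a) := by
  have he : (1 - a) * (a / x) * Real.exp (-b * (x - a)) =
      a * (1 - a) / (x * Real.exp (b * (x - a))) := by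
    rw [neg_mul, Real.exp_neg]
    field_simp
  rw [he, le_div_iff₀ (mul_pos hx (Real.exp_pos _))]
  ring_nf

theorem quadratic_nonpos_of_forall {a b : ℝ} (hb : 0 < b) (ha : 0 < a) (ha1 : a < 1)
    (h : ∀ x ≥ a, x * (1 - x) * Real.exp (b * (x - a)) ≤ a * (1 - a)) :
    -b * a ^ 2 + (b - 2) * a + 1 ≤ 0 := by
  by_contra! hq
  set q := -b * a ^ 2 + (b - 2) * a + 1 with hqd
  have hc : 0 < 2 * (1 + 2 * b) := by positivity
  obtain ⟨t, ht, ht'⟩ := exists_between (lt_min (sub_pos.2 ha1) (div_pos hq hc))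
  obtain ⟨ht1, ht2⟩ := lt_min_iff.1 ht'
  rw [lt_div_iff₀ hc] at ht2
  have h1 := h (a + t) (by linarith)
  rw [add_sub_cancel_left] at h1
  have h2 : (a + t) * (1 - (a + t)) * (b * t + 1) ≤ a * (1 - a) :=
    (mul_le_mul_of_nonneg_left (Real.add_one_le_exp (b * t))
      (mul_nonneg (by linarith) (by linarith))).trans h1
  have h3 : t * (q - t * (1 - b * (1 - 2 * a) + b * t)) ≤ 0 := by
    rw [hqd]
    linarith
  have h4 : 1 - b * (1 - 2 * a) + b * t ≤ 1 + 2 * b := by nlinarith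
  have h5 : 0 < q - t * (1 - b * (1 - 2 * a) + b * t) := by
    nlinarith [mul_le_mul_of_nonneg_left h4 ht.le]
  exact absurd h3 (not_le.2 (mul_pos ht h5))

theorem quadratic_nonpos_iff_sqrt_le {a b : ℝ} (hb : 0 < b) (ha : 0 < a) :
    -b * a ^ 2 + (b - 2) * a + 1 ≤ 0 ↔
      Real.sqrt (1 / 4 + 1 / b ^ 2) - 1 / b + 1 / 2 ≤ a := by
  have hsq : -b * a ^ 2 + (b - 2) * a + 1 =
      b * ((1 / 4 + 1 / b ^ 2) - (a + 1 / b - 1 / 2) ^ 2) := by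
    field_simp
    ring
  have hs : Real.sqrt (1 / 4 + 1 / b ^ 2) - 1 / b + 1 / 2 ≤ a ↔
      Real.sqrt (1 / 4 + 1 / b ^ 2) ≤ a + 1 / b - 1 / 2 := by
    constructor <;> intro h <;> linarith
  rw [hs, Real.sqrt_le_iff]
  constructor
  · intro h
    refine ⟨?_, ?_⟩
    · have h1 : 0 ≤ b * (a + 1 / b - 1 / 2) := by
        have : b * (a + 1 / b - 1 / 2) = b * a + 1 - b / 2 := by field_simp
        rw [this]
        by_contra! h2
        nlinarith [mul_pos ha (neg_pos.2 h2), mul_pos hb ha]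
      exact nonneg_of_mul_nonneg_right h1 hb
    · rw [hsq] at h
      exact sub_nonpos.1 (nonpos_of_mul_nonpos_right h hb)
  · rintro ⟨-, h⟩
    rw [hsq]
    exact mul_nonpos_of_nonneg_of_nonpos hb.le (sub_nonpos.2 h)

theorem stmt_6 (b : ℝ) (hb : 0 < b) (a : ℝ) (ha : a ∈ Set.Ioo (0:ℝ) 1) :
    ((∀ x ≥ a, (1 - a) * (a / x) * Real.exp (-b * (x - a)) ≥ 1 - x) ↔
      -b * a ^ 2 + (b - 2) * a + 1 ≤ 0) ∧
    ((-b * a ^ 2 + (b - 2) * a + 1 ≤ 0) ↔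
      Real.sqrt (1 / 4 + 1 / b ^ 2) - 1 / b + 1 / 2 ≤ a) := by
  obtain ⟨ha0, ha1⟩ := ha
  refine ⟨⟨fun h => ?_, fun h x hx => ?_⟩, quadratic_nonpos_iff_sqrt_le hb ha0⟩
  · exact quadratic_nonpos_of_forall hb ha0 ha1 fun x hx =>
      (payoff_le_iff (ha0.trans_le hx)).1 (h x hx)
  · refine (payoff_le_iff (ha0.trans_le hx)).2 ?_
    simpa using antitoneOn_mul_exp hb ha0 h Set.self_mem_Ici hx hx
end

section
/- Let μ > 0, σ > 0 and f(r) := √((μ/σ² − 1/2)² + 2r/σ²) + μ/σ² − 1/2. Let ν be a Borel probability measure on [0,∞) with essential supremum ρ* ∈ (0,∞) (i.e. ν((ρ*,∞)) = 0 and ν((ρ*−ε,∞)) > 0 for every ε > 0), let α ∈ (0,1), and set L := ∫₀^∞ f(r) dν(r). For 0 < a ≤ x define Λ(x,a) := ∫₀^∞ min{(1−a)·(a/x)^{f(r)}, α} dν(r). Then for every a ∈ (0,1], the property '∀ x ≥ a : Λ(x,a) ≥ min{(1−x)⁺, α}' holds if and only if a ≥ a*, where a* := L/(L+1) if 1−α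 ≤ L/(L+1); a* := 1−α if L/(L+1) < 1−α ≤ f(ρ*)/(f(ρ*)+1); and a* := γ if 1−α > f(ρ*)/(f(ρ*)+1), where γ is the smaller of the two roots in [0,1] of the equation (1−a)·a^{f(ρ*)} = α·(1−α)^{f(ρ*)}. -/
open MeasureTheory

theorem one_sub_mul_rpow_lt {k x y : ℝ} (hk : 0 ≤ k) (hx : 0 < x) (hx1 : x < 1) (hy : 0 < y)
    (hyx : y ≠ x) (h : (y - x) * (k * (1 - x) - x) ≤ 0) :
    (1 - y) * y ^ k < (1 - x) * x ^ k := by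
  have h1x : 0 < 1 - x := by linarith
  have hxk : 0 < x ^ k := Real.rpow_pos_of_pos hx k
  have hyk : y ^ k ≤ x ^ k * Real.exp (k * ((y - x) / x)) := by
    have hlog : Real.log (y / x) ≤ (y - x) / x := by
      have := Real.log_le_sub_one_of_pos (div_pos hy hx)
      rwa [sub_div, div_self hx.ne']
    calc y ^ k = x ^ k * (y / x) ^ k := by
          rw [← Real.mul_rpow hx.le (div_pos hy hx).le, mul_div_cancel₀ _ hx.ne']
      _ = x ^ k * Real.exp (k * Real.log (y / x)) := by
          rw [Real.rpow_def_of_pos (div_pos hy hx), mul_comm k]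
      _ ≤ _ := by gcongr
  have hlin : 1 - y < (1 - x) * Real.exp ((x - y) / (1 - x)) := by
    have hne : (x - y) / (1 - x) ≠ 0 := div_ne_zero (sub_ne_zero.2 hyx.symm) h1x.ne'
    calc 1 - y = (1 - x) * ((x - y) / (1 - x) + 1) := by field_simp; ring
      _ < _ := by gcongr; exact Real.add_one_lt_exp hne
  have hexp : (x - y) / (1 - x) + k * ((y - x) / x) ≤ 0 := by
    have : (x - y) / (1 - x) + k * ((y - x) / x)
        = (y - x) * (k * (1 - x) - x) / ((1 - x) * x) := by field_simp; ring
    rw [this]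
    exact div_nonpos_of_nonpos_of_nonneg h (by positivity)
  calc (1 - y) * y ^ k
      ≤ max (1 - y) 0 * y ^ k := by gcongr; exact le_max_left _ _
    _ ≤ max (1 - y) 0 * (x ^ k * Real.exp (k * ((y - x) / x))) := by gcongr
    _ < (1 - x) * Real.exp ((x - y) / (1 - x)) * (x ^ k * Real.exp (k * ((y - x) / x))) := by
        gcongr
        exact max_lt hlin (by positivity)
    _ = (1 - x) * x ^ k * Real.exp ((x - y) / (1 - x) + k * ((y - x) / x)) := by
        rw [Real.exp_add]; ring
    _ ≤ (1 - x) * x ^ k * 1 := by gcongr; exact Real.exp_le_one_iff.2 hexp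
    _ = _ := mul_one _

theorem one_sub_mul_rpow_le {k x y : ℝ} (hk : 0 ≤ k) (hx : 0 < x) (hx1 : x < 1) (hy : 0 < y)
    (h : (y - x) * (k * (1 - x) - x) ≤ 0) :
    (1 - y) * y ^ k ≤ (1 - x) * x ^ k := by
  rcases eq_or_ne y x with rfl | hyx
  · exact le_rfl
  · exact (one_sub_mul_rpow_lt hk hx hx1 hy hyx h).le

theorem mul_one_sub_le_iff {k x : ℝ} (hk : 0 ≤ k) : k * (1 - x) ≤ x ↔ k / (k + 1) ≤ x := by
  rw [div_le_iff₀ (by linarith)]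
  constructor <;> intro h <;> linarith

theorem le_mul_one_sub_iff {k x : ℝ} (hk : 0 ≤ k) : x ≤ k * (1 - x) ↔ x ≤ k / (k + 1) := by
  rw [le_div_iff₀ (by linarith)]
  constructor <;> intro h <;> linarith

theorem Real.exp_neg_le_one_sub_add_sq {s : ℝ} (hs : 0 ≤ s) : Real.exp (-s) ≤ 1 - s + s ^ 2 := by
  have h1 : s + 1 ≤ Real.exp s := Real.add_one_le_exp s
  rw [Real.exp_neg, inv_le_iff_one_le_mul₀ (Real.exp_pos s)]
  have h2 : 0 ≤ 1 - s + s ^ 2 := by nlinarith [sq_nonneg (s - 1)]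
  nlinarith [mul_le_mul_of_nonneg_left h1 h2, pow_nonneg hs 3]

section DiscountedPut

variable {Ω : Type*} [MeasurableSpace Ω] {ν : Measure Ω} {f : Ω → ℝ} {F α a x : ℝ}

theorem integral_min_mul_rpow_of_one_sub_le (hF : ∀ᵐ r ∂ν, 0 ≤ f r ∧ f r ≤ F)
    (ha : 0 < a) (ha1 : a ≤ 1) (hax : a ≤ x) (haα : 1 - α ≤ a) :
    ∫ r, min ((1 - a) * (a / x) ^ f r) α ∂ν = (1 - a) * ∫ r, (a / x) ^ f r ∂ν := by
  have hx : 0 < x := ha.trans_le hax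
  rw [← integral_const_mul]
  refine integral_congr_ae ?_
  filter_upwards [hF] with r hr
  have h1 : (a / x) ^ f r ≤ 1 :=
    Real.rpow_le_one (div_pos ha hx).le ((div_le_one hx).2 hax) hr.1
  refine min_eq_left ?_
  nlinarith

variable [IsProbabilityMeasure ν]

theorem integrable_of_ae_mem_Icc (hf : Measurable f) (hF : ∀ᵐ r ∂ν, 0 ≤ f r ∧ f r ≤ F) :
    Integrable f ν := by
  refine Integrable.of_bound hf.aestronglyMeasurable F ?_
  filter_upwards [hF] with r hr
  rw [Real.norm_eq_abs, abs_of_nonneg hr.1]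
  exact hr.2

theorem integrable_min_mul_rpow (hf : Measurable f) (hα : 0 ≤ α) (ha : 0 ≤ a) (ha1 : a ≤ 1)
    (hx : 0 ≤ x) : Integrable (fun r => min ((1 - a) * (a / x) ^ f r) α) ν := by
  refine Integrable.of_bound ((((measurable_const.pow hf).const_mul _).min
    measurable_const).aestronglyMeasurable) α ?_
  filter_upwards with r
  have : 0 ≤ (1 - a) * (a / x) ^ f r :=
    mul_nonneg (by linarith) (Real.rpow_nonneg (div_nonneg ha hx) _)
  rw [Real.norm_eq_abs, abs_of_nonneg (le_min this hα)]
  exact min_le_right _ _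

theorem integrable_rpow_div (hf : Measurable f) (hF : ∀ᵐ r ∂ν, 0 ≤ f r ∧ f r ≤ F)
    (ha : 0 < a) (hax : a ≤ x) : Integrable (fun r => (a / x) ^ f r) ν := by
  have hx : 0 < x := ha.trans_le hax
  refine Integrable.of_bound (measurable_const.pow hf).aestronglyMeasurable 1 ?_
  filter_upwards [hF] with r hr
  rw [Real.norm_eq_abs, abs_of_nonneg (Real.rpow_nonneg (div_pos ha hx).le _)]
  exact Real.rpow_le_one (div_pos ha hx).le ((div_le_one hx).2 hax) hr.1

/-- Jensen inequality for the exponent of a power function. -/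
theorem rpow_integral_le_integral_rpow (hf : Measurable f)
    (hF : ∀ᵐ r ∂ν, 0 ≤ f r ∧ f r ≤ F) (ha : 0 < a) (hax : a ≤ x) :
    (a / x) ^ (∫ r, f r ∂ν) ≤ ∫ r, (a / x) ^ f r ∂ν := by
  have hb : 0 < a / x := div_pos ha (ha.trans_le hax)
  set L := ∫ r, f r ∂ν with hL
  set b := a / x
  have hfi : Integrable f ν := integrable_of_ae_mem_Icc hf hF
  have hlog : Integrable (fun r => Real.log b * (f r - L)) ν :=
    (hfi.sub (integrable_const L)).const_mul _
  have hi : Integrable (fun r => b ^ L * (Real.log b * (f r - L) + 1)) ν :=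
    (hlog.add (integrable_const 1)).const_mul _
  calc b ^ L = ∫ r, b ^ L * (Real.log b * (f r - L) + 1) ∂ν := by
        rw [integral_const_mul, integral_add hlog (integrable_const 1), integral_const_mul,
          integral_sub hfi (integrable_const L)]
        simp [← hL]
    _ ≤ _ := by
        refine integral_mono hi (integrable_rpow_div hf hF ha hax) fun r => ?_
        have h1 : b ^ f r = b ^ L * Real.exp (Real.log b * (f r - L)) := by
          rw [← Real.rpow_def_of_pos hb, ← Real.rpow_add hb]; congr 1; ring
        simp only [h1]
        gcongr
        exact Real.add_one_le_exp _

theorem integral_nonneg_and_le (hf : Measurable f) (hF : ∀ᵐ r ∂ν, 0 ≤ f r ∧ f r ≤ F) :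
    0 ≤ ∫ r, f r ∂ν ∧ ∫ r, f r ∂ν ≤ F := by
  constructor
  · exact integral_nonneg_of_ae (hF.mono fun r hr => hr.1)
  · have := integral_mono_ae (integrable_of_ae_mem_Icc hf hF) (integrable_const F)
      (hF.mono fun r hr => hr.2)
    simpa using this

theorem min_le_integral_of_one_sub_le (hf : Measurable f)
    (hF : ∀ᵐ r ∂ν, 0 ≤ f r ∧ f r ≤ F) (ha : 0 < a) (ha1 : a < 1) (hax : a ≤ x)
    (haα : 1 - α ≤ a) (haL : (∫ r, f r ∂ν) * (1 - a) ≤ a) :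
    min (max (1 - x) 0) α ≤ ∫ r, min ((1 - a) * (a / x) ^ f r) α ∂ν := by
  have hx : 0 < x := ha.trans_le hax
  rw [integral_min_mul_rpow_of_one_sub_le hF ha ha1.le hax haα]
  refine (min_le_left _ _).trans (max_le ?_ ?_)
  · set L := ∫ r, f r ∂ν
    have h1 : (1 - x) * x ^ L ≤ (1 - a) * a ^ L :=
      one_sub_mul_rpow_le (integral_nonneg_and_le hf hF).1 ha ha1 hx
        (mul_nonpos_of_nonneg_of_nonpos (by linarith) (by linarith))
    have h2 : 1 - x ≤ (1 - a) * (a / x) ^ L := by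
      rw [Real.div_rpow ha.le hx.le, ← mul_div_assoc, le_div_iff₀ (Real.rpow_pos_of_pos hx L)]
      exact h1
    exact h2.trans (mul_le_mul_of_nonneg_left (rpow_integral_le_integral_rpow hf hF ha hax)
      (by linarith))
  · exact mul_nonneg (by linarith)
      (integral_nonneg fun r => Real.rpow_nonneg (div_pos ha hx).le _)

theorem min_le_integral_of_le_mul_rpow (hf : Measurable f)
    (hF : ∀ᵐ r ∂ν, 0 ≤ f r ∧ f r ≤ F) (hF0 : 0 ≤ F) (hα : α ∈ Set.Ioo (0 : ℝ) 1)
    (ha : 0 < a) (ha1 : a < 1) (hax : a ≤ x)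
    (haα : α * (1 - α) ^ F ≤ (1 - a) * a ^ F) (hαF : F * (1 - (1 - α)) ≤ 1 - α) :
    min (max (1 - x) 0) α ≤ ∫ r, min ((1 - a) * (a / x) ^ f r) α ∂ν := by
  obtain ⟨hα0, hα1⟩ := hα
  have hx : 0 < x := ha.trans_le hax
  have key : min (max (1 - x) 0) α ≤ (1 - a) * (a / x) ^ F := by
    have hxF := Real.rpow_pos_of_pos hx F
    rw [Real.div_rpow ha.le hx.le, ← mul_div_assoc, le_div_iff₀ hxF]
    refine le_trans ?_ haα
    rcases le_total x (1 - α) with h | h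
    · calc _ ≤ α * x ^ F := by gcongr; exact min_le_right _ _
        _ ≤ _ := by gcongr
    · refine (mul_le_mul_of_nonneg_right (min_le_left _ _) hxF.le).trans ?_
      rw [max_mul_of_nonneg _ _ hxF.le, zero_mul]
      refine max_le ?_ (mul_nonneg hα0.le (Real.rpow_nonneg (by linarith) _))
      have := one_sub_mul_rpow_le (k := F) (x := 1 - α) (y := x) hF0 (by linarith) (by linarith) hx
        (mul_nonpos_of_nonneg_of_nonpos (by linarith) (by linarith))
      simpa using this
  calc min (max (1 - x) 0) α = ∫ _, min (max (1 - x) 0) α ∂ν := by simp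
    _ ≤ _ := by
      refine integral_mono_ae (integrable_const _)
        (integrable_min_mul_rpow hf hα0.le ha.le ha1.le hx.le) ?_
      filter_upwards [hF] with r hr
      refine le_min (key.trans ?_) (min_le_right _ _)
      refine mul_le_mul_of_nonneg_left ?_ (by linarith)
      exact Real.rpow_le_rpow_of_exponent_ge (div_pos ha hx) ((div_le_one hx).2 hax) hr.2

theorem le_mul_rpow_of_le_integral (hf : Measurable f)
    (hess : ∀ G < F, 0 < ν {r | G < f r}) (hα : 0 ≤ α)
    (ha : 0 < a) (ha1 : a ≤ 1) (hax : a ≤ x)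
    (h : α ≤ ∫ r, min ((1 - a) * (a / x) ^ f r) α ∂ν) :
    α ≤ (1 - a) * (a / x) ^ F := by
  have hx : 0 < x := ha.trans_le hax
  have hb : 0 < a / x := div_pos ha hx
  have hint := integrable_min_mul_rpow (ν := ν) hf hα ha.le ha1 hx.le
  have hae : ∀ᵐ r ∂ν, α ≤ (1 - a) * (a / x) ^ f r := by
    have h0 : ∫ r, (α - min ((1 - a) * (a / x) ^ f r) α) ∂ν = 0 := by
      refine le_antisymm ?_ (integral_nonneg fun r => sub_nonneg.2 (min_le_right _ _))
      rw [integral_sub (integrable_const _) hint]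
      simpa using h
    rw [integral_eq_zero_iff_of_nonneg (fun r => sub_nonneg.2 (min_le_right _ _))
      ((integrable_const _).sub hint)] at h0
    filter_upwards [h0] with r hr
    have hr' : α = min ((1 - a) * (a / x) ^ f r) α := sub_eq_zero.1 hr
    exact hr'.le.trans (min_le_left _ _)
  have hlt : ∀ G < F, α ≤ (1 - a) * (a / x) ^ G := by
    intro G hG
    by_contra! hc
    refine (hess G hG).ne' (measure_mono_null (fun r hr => ?_) (ae_iff.1 hae))
    simp only [Set.mem_ofPred_eq, not_le] at hr ⊢
    refine lt_of_le_of_lt (mul_le_mul_of_nonneg_left ?_ (by linarith)) hc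
    exact Real.rpow_le_rpow_of_exponent_ge hb ((div_le_one hx).2 hax) hr.le
  have hcont : Continuous fun G : ℝ => (1 - a) * (a / x) ^ G :=
    continuous_const.mul (Real.continuous_const_rpow hb.ne')
  refine ge_of_tendsto (hcont.continuousWithinAt (s := Set.Iio F) (x := F)) ?_
  filter_upwards [self_mem_nhdsWithin] with G hG using hlt G hG

theorem integral_mul_one_sub_le_of_forall (hf : Measurable f)
    (hF : ∀ᵐ r ∂ν, 0 ≤ f r ∧ f r ≤ F)
    (ha : 0 < a) (ha1 : a ≤ 1) (haα : 1 - α ≤ a)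
    (h : ∀ x ≥ a, min (max (1 - x) 0) α ≤ ∫ r, min ((1 - a) * (a / x) ^ f r) α ∂ν) :
    (∫ r, f r ∂ν) * (1 - a) ≤ a := by
  set L := ∫ r, f r ∂ν with hL
  have hfi : Integrable f ν := integrable_of_ae_mem_Icc hf hF
  by_contra! hc
  set D := L * (1 - a) - a with hD
  have hD0 : 0 < D := by linarith
  set C := (1 - a) * F ^ 2 + a with hC
  have hC0 : 0 < C := by
    have : 0 ≤ (1 - a) * F ^ 2 := mul_nonneg (by linarith) (sq_nonneg _)
    linarith
  have key : ∀ t : ℝ, 0 < t → t ≤ 1 → D ≤ C * t := by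
    intro t ht ht1
    set x := a * Real.exp t with hx
    have hax : a ≤ x := le_mul_of_one_le_right ha.le (Real.one_le_exp ht.le)
    have h1 := h x hax
    rw [integral_min_mul_rpow_of_one_sub_le hF ha ha1 hax haα] at h1
    have h2 : 1 - x ≤ min (max (1 - x) 0) α := le_min (le_max_left _ _) (by linarith)
    have h3 : ∫ r, (a / x) ^ f r ∂ν ≤ ∫ r, (1 + F ^ 2 * t ^ 2 - t * f r) ∂ν := by
      refine integral_mono_ae (integrable_rpow_div hf hF ha hax)
        ((integrable_const _).sub (hfi.const_mul t)) ?_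
      filter_upwards [hF] with r hr
      have hb : a / x = Real.exp (-t) := by
        rw [hx, Real.exp_neg]; field_simp
      rw [hb, ← Real.exp_mul]
      have h4 := Real.exp_neg_le_one_sub_add_sq (mul_nonneg ht.le hr.1)
      have h5 : (t * f r) ^ 2 ≤ F ^ 2 * t ^ 2 := by
        rw [← mul_pow, mul_comm F]
        gcongr
        · exact mul_nonneg ht.le hr.1
        · exact hr.2
      rw [neg_mul]
      linarith
    rw [integral_sub (integrable_const _) (hfi.const_mul t), integral_const_mul, ← hL] at h3
    simp only [integral_const, probReal_univ, one_smul] at h3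
    have h6 : Real.exp t ≤ 1 + t + t ^ 2 := by
      have := (abs_le.1 (Real.abs_exp_sub_one_sub_id_le (abs_le.2 ⟨by linarith, ht1⟩))).2
      linarith
    have h7 : x ≤ a * (1 + t + t ^ 2) := by rw [hx]; gcongr
    have h8 := mul_le_mul_of_nonneg_left h3 (sub_nonneg.2 ha1)
    have h9 : D * t ≤ C * t * t := by rw [hD, hC]; nlinarith
    exact le_of_mul_le_mul_right h9 ht
  have hCD : 0 < C + D := by linarith
  have h1 := key (D / (C + D)) (div_pos hD0 hCD) ((div_le_one hCD).2 (by linarith))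
  rw [← mul_div_assoc, le_div_iff₀ hCD] at h1
  nlinarith

end DiscountedPut

theorem stmt_7 (μ σ : ℝ) (hμ : 0 < μ) (hσ : 0 < σ)
    (f : ℝ → ℝ)
    (hf : ∀ r, f r = Real.sqrt ((μ / σ ^ 2 - 1 / 2) ^ 2 + 2 * r / σ ^ 2) + μ / σ ^ 2 - 1 / 2)
    (ν : Measure ℝ) [IsProbabilityMeasure ν] (hν : ν (Set.Iio 0) = 0)
    (ρstar : ℝ) (hρ : 0 < ρstar) (hsupp : ν (Set.Ioi ρstar) = 0)
    (hess : ∀ ε > (0:ℝ), 0 < ν (Set.Ioi (ρstar - ε)))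
    (α : ℝ) (hα : α ∈ Set.Ioo (0:ℝ) 1)
    (L : ℝ) (hL : L = ∫ r, f r ∂ν)
    (Λ : ℝ → ℝ → ℝ)
    (hΛ : ∀ x a, 0 < a → a ≤ x → Λ x a = ∫ r, min ((1 - a) * (a / x) ^ f r) α ∂ν)
    (γ : ℝ) (hγmem : γ ∈ Set.Icc (0:ℝ) 1)
    (hγroot : (1 - γ) * γ ^ f ρstar = α * (1 - α) ^ f ρstar)
    (hγmin : ∀ a ∈ Set.Icc (0:ℝ) 1, (1 - a) * a ^ f ρstar = α * (1 - α) ^ f ρstar → γ ≤ a)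
    (astar : ℝ)
    (hastar : astar = if 1 - α ≤ L / (L + 1) then L / (L + 1)
      else if 1 - α ≤ f ρstar / (f ρstar + 1) then 1 - α else γ) :
    ∀ a ∈ Set.Ioc (0:ℝ) 1,
      (∀ x ≥ a, Λ x a ≥ min (max (1 - x) 0) α) ↔ astar ≤ a := by
  have hσ2 : 0 < σ ^ 2 := by positivity
  set p := μ / σ ^ 2 - 1 / 2 with hp
  have hf' : ∀ r, f r = Real.sqrt (p ^ 2 + 2 * r / σ ^ 2) + p := fun r => by rw [hf r]; ring
  have hmono : Monotone f := by
    intro r s hrs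
    rw [hf' r, hf' s]
    gcongr
  have hcont : Continuous f := by
    rw [funext hf']
    fun_prop
  have hmeas : Measurable f := hcont.measurable
  have hnonneg : ∀ r, 0 ≤ r → 0 ≤ f r := by
    intro r hr
    have h1 : |p| ≤ Real.sqrt (p ^ 2 + 2 * r / σ ^ 2) :=
      Real.abs_le_sqrt (le_add_of_nonneg_right (by positivity))
    rw [hf' r]
    linarith [neg_abs_le p]
  set F := f ρstar with hFdef
  have hF0 : 0 < F := by
    have h1 : |p| < Real.sqrt (p ^ 2 + 2 * ρstar / σ ^ 2) := by
      rw [Real.lt_sqrt (abs_nonneg p), sq_abs]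
      exact lt_add_of_pos_right _ (by positivity)
    rw [hFdef, hf' ρstar]
    linarith [neg_abs_le p]
  have hF : ∀ᵐ r ∂ν, 0 ≤ f r ∧ f r ≤ F := by
    have h1 : ∀ᵐ r ∂ν, r ∉ Set.Iio (0 : ℝ) := measure_eq_zero_iff_ae_notMem.1 hν
    have h2 : ∀ᵐ r ∂ν, r ∉ Set.Ioi ρstar := measure_eq_zero_iff_ae_notMem.1 hsupp
    filter_upwards [h1, h2] with r hr1 hr2
    exact ⟨hnonneg r (not_lt.1 hr1), hmono (not_lt.1 hr2)⟩
  have hessF : ∀ G < F, 0 < ν {r | G < f r} := by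
    intro G hG
    obtain ⟨l, hl, hlG⟩ := exists_Ioc_subset_of_mem_nhds
      (hcont.continuousAt.eventually (lt_mem_nhds hG)) ⟨ρstar - 1, by linarith⟩
    refine (hess (ρstar - l) (by linarith)).trans_le (measure_mono fun r hr => ?_)
    have hr : l < r := by simpa using hr
    rcases le_total r ρstar with h | h
    · exact hlG ⟨hr, h⟩
    · exact hG.trans_le (hmono h)
  obtain ⟨hL0, hLF⟩ : 0 ≤ L ∧ L ≤ F := hL ▸ integral_nonneg_and_le hmeas hF
  obtain ⟨hα0, hα1⟩ := hα
  intro a ⟨ha, ha1⟩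
  have hiff : (∀ x ≥ a, Λ x a ≥ min (max (1 - x) 0) α) ↔
      ∀ x ≥ a, min (max (1 - x) 0) α ≤ ∫ r, min ((1 - a) * (a / x) ^ f r) α ∂ν :=
    forall₂_congr fun x hx => by rw [hΛ x a ha hx, ge_iff_le]
  rw [hiff]
  have hγα : γ ≤ 1 - α := hγmin (1 - α) ⟨by linarith, by linarith⟩ (by rw [sub_sub_cancel])
  have hastar1 : astar ≤ 1 := by
    rw [hastar]
    split_ifs
    · exact div_le_one_of_le₀ (by linarith) (by linarith)
    · linarith
    · linarith
  have hmon : a < 1 - α → (∀ x ≥ a,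
      min (max (1 - x) 0) α ≤ ∫ r, min ((1 - a) * (a / x) ^ f r) α ∂ν) →
      α * (1 - α) ^ F ≤ (1 - a) * a ^ F := by
    intro haα h
    have h1 := h (1 - α) haα.le
    rw [sub_sub_cancel, max_eq_left hα0.le, min_self] at h1
    have h2 := le_mul_rpow_of_le_integral hmeas hessF hα0.le ha ha1 haα.le h1
    rwa [Real.div_rpow ha.le (by linarith), ← mul_div_assoc,
      le_div_iff₀ (Real.rpow_pos_of_pos (by linarith) F)] at h2
  have hnec : 1 - α ≤ F / (F + 1) → (∀ x ≥ a,
      min (max (1 - x) 0) α ≤ ∫ r, min ((1 - a) * (a / x) ^ f r) α ∂ν) → 1 - α ≤ a := by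
    intro hαF h
    by_contra! haα
    have h1 := hmon haα h
    have h2 := one_sub_mul_rpow_lt (k := F) (x := 1 - α) (y := a) hF0.le (by linarith)
      (by linarith) ha haα.ne (mul_nonpos_of_nonpos_of_nonneg (by linarith)
        (sub_nonneg.2 ((le_mul_one_sub_iff hF0.le).2 hαF)))
    rw [sub_sub_cancel] at h2
    linarith
  have hLFdiv : L / (L + 1) ≤ F / (F + 1) := by
    rw [div_le_div_iff₀ (by linarith) (by linarith)]
    linarith
  have hsuff : a < 1 → 1 - α ≤ a → L / (L + 1) ≤ a → ∀ x ≥ a,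
      min (max (1 - x) 0) α ≤ ∫ r, min ((1 - a) * (a / x) ^ f r) α ∂ν := by
    intro ha1 haα haL x hx
    exact min_le_integral_of_one_sub_le hmeas hF ha ha1 hx haα
      (hL ▸ (mul_one_sub_le_iff hL0).2 haL)
  rcases ha1.eq_or_lt with rfl | ha1'
  · refine iff_of_true (fun x hx => ?_) hastar1
    rw [max_eq_right (by linarith), min_eq_left hα0.le]
    simp [hα0.le]
  rw [hastar]
  split_ifs with h1 h2
  · refine ⟨fun h => ?_, fun h => hsuff ha1' (h1.trans h) h⟩
    have haα := hnec (h1.trans hLFdiv) h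
    exact (mul_one_sub_le_iff hL0).1
      (hL ▸ integral_mul_one_sub_le_of_forall hmeas hF ha ha1 haα h)
  · exact ⟨hnec h2, fun h => hsuff ha1' h ((not_le.1 h1).le.trans h)⟩
  · have h2 := (not_le.1 h2).le
    refine ⟨fun h => ?_, fun h => ?_⟩
    · by_contra! haγ
      have hroot := hmon (haγ.trans_le hγα) h
      have hc : ContinuousOn (fun y : ℝ => (1 - y) * y ^ F) (Set.Icc 0 a) :=
        ((continuous_const.sub continuous_id).mul
          (Real.continuous_rpow_const hF0.le)).continuousOn
      have hmem : α * (1 - α) ^ F ∈ Set.Icc ((1 - 0) * (0 : ℝ) ^ F) ((1 - a) * a ^ F) := by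
        rw [Real.zero_rpow hF0.ne', mul_zero]
        exact ⟨mul_nonneg hα0.le (Real.rpow_nonneg (by linarith) _), hroot⟩
      obtain ⟨y, hy, hyroot⟩ := intermediate_value_Icc ha.le hc hmem
      have := hγmin y ⟨hy.1, hy.2.trans ha1⟩ hyroot
      linarith [hy.2]
    · rcases le_or_gt (1 - α) a with haα | haα
      · exact hsuff ha1' haα (hLFdiv.trans (h2.trans haα))
      · intro x hx
        refine min_le_integral_of_le_mul_rpow hmeas hF hF0.le ⟨hα0, hα1⟩ ha ha1' hx ?_
          ((mul_one_sub_le_iff hF0.le).2 h2)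
        rcases le_total a (F / (F + 1)) with haF | haF
        · rw [← hγroot]
          rcases hγmem.1.eq_or_lt with h0 | h0
          · rw [← h0, Real.zero_rpow hF0.ne', mul_zero]
            exact mul_nonneg (by linarith) (Real.rpow_nonneg ha.le _)
          · exact one_sub_mul_rpow_le hF0.le ha ha1' h0
              (mul_nonpos_of_nonpos_of_nonneg (by linarith)
                (sub_nonneg.2 ((le_mul_one_sub_iff hF0.le).2 haF)))
        · have := one_sub_mul_rpow_le (y := 1 - α) hF0.le ha ha1' (by linarith)
            (mul_nonpos_of_nonneg_of_nonpos (by linarith)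
              (sub_nonpos.2 ((mul_one_sub_le_iff hF0.le).2 haF)))
          rwa [sub_sub_cancel] at this
end

section
/- The function r ↦ x*(r) := √(1/4 + 1/(2r)) − 1/√(2r) + 1/2 is strictly increasing on (0,∞). -/
theorem Real.strictAnti_sqrt_add_sq_sub {c : ℝ} (hc : 0 < c) :
    StrictAnti (fun s : ℝ => Real.sqrt (c + s ^ 2) - s) := by
  intro s t hst
  have lt_sqrt (x : ℝ) : x < Real.sqrt (c + x ^ 2) := Real.lt_sqrt_of_sq_lt (by linarith)
  have sq_sqrt (x : ℝ) : Real.sqrt (c + x ^ 2) ^ 2 = c + x ^ 2 := Real.sq_sqrt (by positivity)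
  have hs := sq_sqrt s
  have ht := sq_sqrt t
  have hsum := mul_pos (sub_pos.2 hst) (sub_pos.2 (add_lt_add (lt_sqrt s) (lt_sqrt t)))
  by_contra! h
  have hmul := mul_nonneg (sub_nonneg.2 h)
    (add_nonneg (Real.sqrt_nonneg (c + s ^ 2)) (Real.sqrt_nonneg (c + t ^ 2)))
  nlinarith

theorem stmt_11 :
    StrictMonoOn (fun r : ℝ => Real.sqrt (1 / 4 + 1 / (2 * r)) - 1 / Real.sqrt (2 * r) + 1 / 2)
      (Set.Ioi 0) := by
  intro a ha b hb hab
  rw [Set.mem_Ioi] at ha hb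
  have one_div_sqrt_sq {r : ℝ} (hr : 0 < r) : (1 / Real.sqrt (2 * r)) ^ 2 = 1 / (2 * r) := by
    rw [div_pow, one_pow, Real.sq_sqrt (by positivity)]
  have hlt : 1 / Real.sqrt (2 * b) < 1 / Real.sqrt (2 * a) :=
    one_div_lt_one_div_of_lt (Real.sqrt_pos.2 (by positivity))
      (Real.sqrt_lt_sqrt (by positivity) (by linarith))
  have h := Real.strictAnti_sqrt_add_sq_sub (c := 1 / 4) (by norm_num) hlt
  simp only [one_div_sqrt_sq ha, one_div_sqrt_sq hb] at h
  exact add_lt_add_left h _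
end

section
/- Let b > 0 and α ∈ (0,1), and set x*(b²/2) := √(1/4 + 1/b²) − 1/b + 1/2. If 1−α > x*(b²/2), then the equation (1−γ)·γ·e^{b·γ} = α·(1−α)·e^{b·(1−α)} has a unique solution γ in the interval [0, 1−α), and this solution satisfies 0 < γ < x*(b²/2). -/
lemma hasDerivAt_one_sub_mul_mul_exp (b x : ℝ) :
    HasDerivAt (fun x : ℝ => (1 - x) * x * Real.exp (b * x))
      ((1 - 2 * x + b * (x - x ^ 2)) * Real.exp (b * x)) x := by
  have h := (((hasDerivAt_id x).const_sub 1).mul (hasDerivAt_id x)).mul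
    ((hasDerivAt_id x).const_mul b).exp
  refine h.congr_deriv ?_
  simp only [id, Pi.mul_apply]
  ring

lemma continuous_one_sub_mul_mul_exp (b : ℝ) :
    Continuous (fun x : ℝ => (1 - x) * x * Real.exp (b * x)) := by
  fun_prop

/-- The point `√(1/4 + 1/b²) - 1/b + 1/2` exceeds `1/2` and is a critical point of
`x ↦ (1 - x) x exp (b x)`. -/
lemma half_lt_and_critical {b s : ℝ} (hb : 0 < b)
    (hs : s = Real.sqrt (1 / 4 + 1 / b ^ 2) - 1 / b + 1 / 2) :
    1 / 2 < s ∧ 2 * s - 1 = b * (s - s ^ 2) := by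
  have hlt : 1 / b < Real.sqrt (1 / 4 + 1 / b ^ 2) := by
    apply Real.lt_sqrt_of_sq_lt
    rw [div_pow, one_pow]
    linarith
  refine ⟨by linarith, ?_⟩
  have hsq : (s - 1 / 2 + 1 / b) ^ 2 = 1 / 4 + 1 / b ^ 2 := by
    rw [show s - 1 / 2 + 1 / b = Real.sqrt (1 / 4 + 1 / b ^ 2) by rw [hs]; ring]
    exact Real.sq_sqrt (by positivity)
  field_simp at hsq
  have : b * (2 * s - 1 - b * (s - s ^ 2)) = 0 := by linear_combination hsq / 16
  rcases mul_eq_zero.mp this with h | h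
  · exact absurd h hb.ne'
  · linarith

/-- Factorization of the polynomial factor of the derivative at a critical point `s`, with the
cofactor positive on the nonnegative half-line. -/
lemma exists_pos_factor {b s x : ℝ} (hb : 0 < b) (hs : 1 / 2 < s)
    (hc : 2 * s - 1 = b * (s - s ^ 2)) (hx : 0 ≤ x) :
    ∃ k > 0, 1 - 2 * x + b * (x - x ^ 2) = (s - x) * k := by
  refine ⟨2 - b + b * (x + s), ?_, by linear_combination -hc⟩
  have h : 0 < s * (2 - b + b * s) := by linarith
  have := pos_of_mul_pos_right h (by linarith)
  nlinarith [mul_nonneg hb.le hx]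

lemma strictMonoOn_one_sub_mul_mul_exp {b s : ℝ} (hb : 0 < b) (hs : 1 / 2 < s)
    (hc : 2 * s - 1 = b * (s - s ^ 2)) :
    StrictMonoOn (fun x : ℝ => (1 - x) * x * Real.exp (b * x)) (Set.Icc 0 s) := by
  refine strictMonoOn_of_deriv_pos (convex_Icc 0 s)
    (continuous_one_sub_mul_mul_exp b).continuousOn fun x hx => ?_
  rw [interior_Icc] at hx
  obtain ⟨k, hk, h⟩ := exists_pos_factor hb hs hc hx.1.le
  rw [(hasDerivAt_one_sub_mul_mul_exp b x).deriv, h]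
  exact mul_pos (mul_pos (sub_pos.mpr hx.2) hk) (Real.exp_pos _)

lemma strictAntiOn_one_sub_mul_mul_exp {b s : ℝ} (hb : 0 < b) (hs : 1 / 2 < s)
    (hc : 2 * s - 1 = b * (s - s ^ 2)) :
    StrictAntiOn (fun x : ℝ => (1 - x) * x * Real.exp (b * x)) (Set.Ici s) := by
  refine strictAntiOn_of_deriv_neg (convex_Ici s)
    (continuous_one_sub_mul_mul_exp b).continuousOn fun x hx => ?_
  rw [interior_Ici] at hx
  have hsx : s < x := hx
  obtain ⟨k, hk, h⟩ := exists_pos_factor (x := x) hb hs hc (by linarith)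
  rw [(hasDerivAt_one_sub_mul_mul_exp b x).deriv, h]
  exact mul_neg_of_neg_of_pos (mul_neg_of_neg_of_pos (sub_neg.mpr hsx) hk) (Real.exp_pos _)


theorem stmt_12 (b α : ℝ) (hb : 0 < b) (hα : α ∈ Set.Ioo (0:ℝ) 1)
    (xstar : ℝ) (hx : xstar = Real.sqrt (1 / 4 + 1 / b ^ 2) - 1 / b + 1 / 2)
    (h1 : 1 - α > xstar) :
    (∃! γ, γ ∈ Set.Ico (0:ℝ) (1 - α) ∧
      (1 - γ) * γ * Real.exp (b * γ) = α * (1 - α) * Real.exp (b * (1 - α))) ∧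
    (∀ γ ∈ Set.Ico (0:ℝ) (1 - α),
      (1 - γ) * γ * Real.exp (b * γ) = α * (1 - α) * Real.exp (b * (1 - α)) →
      0 < γ ∧ γ < xstar) := by
  obtain ⟨hs, hc⟩ := half_lt_and_critical hb hx
  have hmono := strictMonoOn_one_sub_mul_mul_exp hb hs hc
  have hanti := strictAntiOn_one_sub_mul_mul_exp hb hs hc
  obtain ⟨hα0, hα1⟩ := hα
  have hpos : 0 < α * (1 - α) * Real.exp (b * (1 - α)) :=
    mul_pos (mul_pos hα0 (by linarith)) (Real.exp_pos _)
  have hval : (1 - (1 - α)) * (1 - α) * Real.exp (b * (1 - α)) =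
      α * (1 - α) * Real.exp (b * (1 - α)) := by ring
  have hbound : ∀ γ ∈ Set.Ico (0:ℝ) (1 - α),
      (1 - γ) * γ * Real.exp (b * γ) = α * (1 - α) * Real.exp (b * (1 - α)) →
      0 < γ ∧ γ < xstar := by
    rintro γ ⟨h0, hlt⟩ heq
    constructor
    · refine lt_of_le_of_ne h0 ?_
      rintro rfl
      simp only [mul_zero, zero_mul] at heq
      exact hpos.ne heq
    · by_contra! hle
      have : (1 - (1 - α)) * (1 - α) * Real.exp (b * (1 - α)) <
          (1 - γ) * γ * Real.exp (b * γ) :=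
        hanti (Set.mem_Ici.mpr hle) (Set.mem_Ici.mpr h1.le) hlt
      linarith
  have hmax : (1 - (1 - α)) * (1 - α) * Real.exp (b * (1 - α)) <
      (1 - xstar) * xstar * Real.exp (b * xstar) :=
    hanti (Set.mem_Ici.mpr le_rfl) (Set.mem_Ici.mpr h1.le) h1
  obtain ⟨γ, hγ, hγeq⟩ := intermediate_value_Icc (by linarith : (0:ℝ) ≤ xstar)
    (continuous_one_sub_mul_mul_exp b).continuousOn
    (show α * (1 - α) * Real.exp (b * (1 - α)) ∈ Set.Icc _ _ from
      ⟨by simpa only [mul_zero, zero_mul] using hpos.le, by linarith⟩)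
  refine ⟨⟨γ, ⟨⟨hγ.1, hγ.2.trans_lt h1⟩, hγeq⟩, ?_⟩, hbound⟩
  rintro y ⟨hy, hyeq⟩
  exact hmono.injOn ⟨hy.1, (hbound y hy hyeq).2.le⟩ hγ (hyeq.trans hγeq.symm)
end

section
/- Let ν be a Borel probability measure on [0,∞) with c := ∫₀^∞ √(2r) dν(r) ∈ (0,∞), and set a° := √(1/4 + 1/c²) − 1/c + 1/2. Then for every x > 0 and all a, a' with a° ≤ a ≤ a' ≤ min(x, 1), one has (1−a')·(a'/x)·∫₀^∞ e^{−√(2r)(x−a')} dν(r) ≤ (1−a)·(a/x)·∫₀^∞ e^{−√(2r)(x−a)} dν(r). -/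
open MeasureTheory

/-- Chebyshev's integral inequality for the oppositely monotone functions `t ↦ t` and
`t ↦ exp (-t * y)` of an integrable random variable. -/
lemma integral_exp_mul_sub_mean_nonpos {Ω : Type*} [MeasurableSpace Ω] {μ : Measure Ω}
    [IsProbabilityMeasure μ] {X : Ω → ℝ} (hX : Integrable X μ) {y : ℝ} (hy : 0 ≤ y)
    (hu : Integrable (fun ω => Real.exp (-X ω * y) * (X ω - ∫ ω', X ω' ∂μ)) μ) :
    ∫ ω, Real.exp (-X ω * y) * (X ω - ∫ ω', X ω' ∂μ) ∂μ ≤ 0 := by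
  set c := ∫ ω', X ω' ∂μ with hc
  have hXc : Integrable (fun ω => X ω - c) μ := hX.sub (integrable_const c)
  have hzero : ∫ ω, Real.exp (-c * y) * (X ω - c) ∂μ = 0 := by
    rw [integral_const_mul, integral_sub hX (integrable_const c)]
    simp [hc]
  rw [← hzero]
  refine integral_mono hu (hXc.const_mul _) fun ω => ?_
  rcases le_total c (X ω) with h | h
  · exact mul_le_mul_of_nonneg_right (Real.exp_le_exp.2 (by nlinarith)) (by linarith)
  · exact mul_le_mul_of_nonpos_right (Real.exp_le_exp.2 (by nlinarith)) (by linarith)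

/-- The Laplace transform of a nonnegative integrable random variable decays at most at the
exponential rate given by the mean. -/
lemma integral_exp_neg_mul_le_exp_mean_mul {Ω : Type*} [MeasurableSpace Ω] {μ : Measure Ω}
    [IsProbabilityMeasure μ] {X : Ω → ℝ} (hX : Integrable X μ) (hX0 : ∀ ω, 0 ≤ X ω)
    {y z : ℝ} (hy : 0 ≤ y) (hyz : y ≤ z) :
    ∫ ω, Real.exp (-X ω * y) ∂μ ≤
      Real.exp ((∫ ω, X ω ∂μ) * (z - y)) * ∫ ω, Real.exp (-X ω * z) ∂μ := by
  have hmeas (w : ℝ) : AEStronglyMeasurable (fun ω => Real.exp (-X ω * w)) μ :=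
    Real.continuous_exp.comp_aestronglyMeasurable (hX.aestronglyMeasurable.neg.mul_const w)
  have hbound (w : ℝ) (hw : 0 ≤ w) (ω : Ω) : ‖Real.exp (-X ω * w)‖ ≤ 1 := by
    rw [Real.norm_eq_abs, Real.abs_exp, Real.exp_le_one_iff]
    nlinarith [mul_nonneg (hX0 ω) hw]
  have hexp (w : ℝ) (hw : 0 ≤ w) : Integrable (fun ω => Real.exp (-X ω * w)) μ :=
    (integrable_const (1 : ℝ)).mono' (hmeas w) (.of_forall (hbound w hw))
  set c := ∫ ω, X ω ∂μ with hc
  have hu : Integrable (fun ω => Real.exp (-X ω * y) * (X ω - c)) μ :=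
    (hX.sub (integrable_const c)).bdd_mul (hmeas y) (.of_forall (hbound y hy))
  have hcheb : ∫ ω, Real.exp (-X ω * y) * (X ω - c) ∂μ ≤ 0 :=
    integral_exp_mul_sub_mean_nonpos hX hy hu
  have hmono : ∫ ω, (Real.exp (-X ω * y) - (z - y) * (Real.exp (-X ω * y) * (X ω - c))) ∂μ ≤
      ∫ ω, Real.exp (c * (z - y)) * Real.exp (-X ω * z) ∂μ := by
    refine integral_mono ((hexp y hy).sub (hu.const_mul _))
      ((hexp z (hy.trans hyz)).const_mul _) fun ω => ?_
    have hsplit : Real.exp (c * (z - y)) * Real.exp (-X ω * z) =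
        Real.exp (-X ω * y) * Real.exp (-(z - y) * (X ω - c)) := by
      rw [← Real.exp_add, ← Real.exp_add]
      ring_nf
    have htangent := Real.add_one_le_exp (-(z - y) * (X ω - c))
    simp only [hsplit]
    nlinarith [mul_le_mul_of_nonneg_left htangent (Real.exp_pos (-X ω * y)).le]
  rw [integral_sub (hexp y hy) (hu.const_mul _), integral_const_mul, integral_const_mul] at hmono
  nlinarith [mul_nonneg (sub_nonneg.2 hyz) (neg_nonneg.2 hcheb)]

/-- The function `a ↦ a * (1 - a) * exp (c * a)` decreases on `[a, 1]` once its derivative at `a` is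
nonpositive. -/
lemma mul_one_sub_mul_exp_le {a b c : ℝ} (ha : 0 < a) (hab : a ≤ b) (hb : b ≤ 1)
    (hcrit : 1 - 2 * a + c * (a * (1 - a)) ≤ 0) :
    (1 - b) * b * Real.exp (c * (b - a)) ≤ (1 - a) * a := by
  rcases hb.eq_or_lt with rfl | hb1
  · nlinarith
  have ha1 : 0 < 1 - a := by linarith
  have hleft : b ≤ a * Real.exp ((b - a) / a) := by
    have h := mul_le_mul_of_nonneg_left (Real.add_one_le_exp ((b - a) / a)) ha.le
    rwa [show a * ((b - a) / a + 1) = b by field_simp; ring] at h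
  have hright : 1 - b ≤ (1 - a) * Real.exp (-(b - a) / (1 - a)) := by
    have h := mul_le_mul_of_nonneg_left (Real.add_one_le_exp (-(b - a) / (1 - a))) ha1.le
    rwa [show (1 - a) * (-(b - a) / (1 - a) + 1) = 1 - b by field_simp; ring] at h
  have hexponent : -(b - a) / (1 - a) + (b - a) / a + c * (b - a) ≤ 0 := by
    rw [show -(b - a) / (1 - a) + (b - a) / a + c * (b - a) =
      (b - a) * (1 - 2 * a + c * (a * (1 - a))) / (a * (1 - a)) by field_simp; ring]
    exact div_nonpos_of_nonpos_of_nonneg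
      (mul_nonpos_of_nonneg_of_nonpos (by linarith) hcrit) (by positivity)
  calc (1 - b) * b * Real.exp (c * (b - a))
      ≤ (1 - a) * Real.exp (-(b - a) / (1 - a)) * (a * Real.exp ((b - a) / a)) *
          Real.exp (c * (b - a)) := by
        gcongr
        linarith
    _ = (1 - a) * a * Real.exp (-(b - a) / (1 - a) + (b - a) / a + c * (b - a)) := by
        rw [Real.exp_add, Real.exp_add]
        ring
    _ ≤ (1 - a) * a :=
        mul_le_of_le_one_right (by positivity) (Real.exp_le_one_iff.2 hexponent)

theorem stmt_13 (ν : Measure ℝ) [IsProbabilityMeasure ν] (hν : ν (Set.Iio 0) = 0)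
    (hint : Integrable (fun r => Real.sqrt (2 * r)) ν)
    (c : ℝ) (hc : c = ∫ r, Real.sqrt (2 * r) ∂ν) (hcpos : 0 < c)
    (acirc : ℝ) (ha : acirc = Real.sqrt (1 / 4 + 1 / c ^ 2) - 1 / c + 1 / 2) :
    ∀ x > (0:ℝ), ∀ a a', acirc ≤ a → a ≤ a' → a' ≤ min x 1 →
      (1 - a') * (a' / x) * ∫ r, Real.exp (-Real.sqrt (2 * r) * (x - a')) ∂ν ≤
      (1 - a) * (a / x) * ∫ r, Real.exp (-Real.sqrt (2 * r) * (x - a)) ∂ν := by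
  intro x hx a b hale hab hb
  obtain ⟨hbx, hb1⟩ := le_min_iff.1 hb
  have hroot : 1 / c ≤ Real.sqrt (1 / 4 + 1 / c ^ 2) :=
    Real.le_sqrt_of_sq_le (by rw [div_pow, one_pow]; linarith)
  have hcinv : 0 < 1 / c := by positivity
  have ha0 : 0 < a := by linarith
  have hcrit : 1 - 2 * a + c * (a * (1 - a)) ≤ 0 := by
    have hsq : 1 / 4 + (1 / c) ^ 2 ≤ (a + 1 / c - 1 / 2) ^ 2 := by
      rw [div_pow, one_pow]
      exact (Real.sqrt_le_left (by linarith)).1 (by linarith)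
    have hquad : (1 - 2 * a) * (1 / c) + a * (1 - a) ≤ 0 := by nlinarith
    have h := mul_nonpos_of_nonneg_of_nonpos hcpos.le hquad
    rwa [mul_add, mul_left_comm, mul_one_div_cancel hcpos.ne', mul_one] at h
  have hlaplace := integral_exp_neg_mul_le_exp_mean_mul hint (fun r => Real.sqrt_nonneg _)
    (sub_nonneg.2 hbx) (sub_le_sub_left hab x)
  rw [← hc, sub_sub_sub_cancel_left] at hlaplace
  have hpayoff := mul_one_sub_mul_exp_le ha0 hab hb1 hcrit
  have hI : 0 ≤ ∫ r, Real.exp (-Real.sqrt (2 * r) * (x - a)) ∂ν :=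
    integral_nonneg fun r => (Real.exp_pos _).le
  have hb0 : 0 ≤ (1 - b) * b := mul_nonneg (by linarith) (by linarith)
  rw [← mul_div_assoc, ← mul_div_assoc, div_mul_eq_mul_div, div_mul_eq_mul_div]
  refine div_le_div_of_nonneg_right ?_ hx.le
  refine (mul_le_mul_of_nonneg_left hlaplace hb0).trans ?_
  rw [← mul_assoc]
  exact mul_le_mul_of_nonneg_right hpayoff hI
end

section
/- Let β > 0 and α ∈ (0,1) with 1−α > β/(1+β). Let γ be the smaller root in [0,1] of (1−a)·a^β = α·(1−α)^β. For x ≥ a > 0 define Λ(x,a) := (1/2)·min{1−a, α} + (1/2)·min{(1−a)·(a/x)^β, α}, and for 0 ≤ x < a define Λ(x,a) := min{(1−x)⁺, α}. Then: (i) γ < β/(1+β); (ii) for every x ≥ 0 and every a ∈ [γ, 1], Λ(x,a) ≤ Λ(x, β/(1+β)). -/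
/-- On `(0, 1]`, the function `a ↦ (1 - a) * a ^ β` is strictly maximized at `β / (1 + β)`. -/
theorem one_sub_mul_rpow_lt_s14 {β a : ℝ} (hβ : 0 < β) (ha : 0 < a) (ha1 : a ≤ 1)
    (hne : a ≠ β / (1 + β)) :
    (1 - a) * a ^ β < (1 - β / (1 + β)) * (β / (1 + β)) ^ β := by
  have hb1 : 1 - β / (1 + β) = 1 / (1 + β) := by field_simp; ring
  set b := β / (1 + β) with hb
  have hb0 : 0 < b := by positivity
  have hb1' : 0 < 1 - b := by rw [hb1]; positivity
  rcases ha1.eq_or_lt with rfl | ha1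
  · rw [sub_self, zero_mul]; positivity
  have h1a : 0 < 1 - a := by linarith
  have hlog := Real.log_lt_sub_one_of_pos (div_pos ha hb0)
    (fun h => hne ((div_eq_one_iff_eq hb0.ne').mp h))
  have hlog' := Real.log_le_sub_one_of_pos (div_pos h1a hb1')
  have hsum : β * (a / b - 1) + ((1 - a) / (1 - b) - 1) = 0 := by
    rw [hb1, hb]; field_simp; ring
  rw [Real.log_div ha.ne' hb0.ne'] at hlog
  rw [Real.log_div h1a.ne' hb1'.ne'] at hlog'
  have hmul := mul_lt_mul_of_pos_left hlog hβ
  rw [← Real.log_lt_log_iff (by positivity) (by positivity),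
    Real.log_mul h1a.ne' (by positivity), Real.log_mul hb1'.ne' (by positivity),
    Real.log_rpow ha, Real.log_rpow hb0]
  linarith

theorem stmt_14 (β α : ℝ) (hβ : 0 < β) (hα : α ∈ Set.Ioo (0:ℝ) 1)
    (h1 : 1 - α > β / (1 + β))
    (γ : ℝ) (hγmem : γ ∈ Set.Icc (0:ℝ) 1)
    (hγroot : (1 - γ) * γ ^ β = α * (1 - α) ^ β)
    (hγmin : ∀ a ∈ Set.Icc (0:ℝ) 1, (1 - a) * a ^ β = α * (1 - α) ^ β → γ ≤ a)
    (Λ : ℝ → ℝ → ℝ)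
    (hΛ₁ : ∀ x a, 0 < a → a ≤ x →
      Λ x a = (1 / 2) * min (1 - a) α + (1 / 2) * min ((1 - a) * (a / x) ^ β) α)
    (hΛ₂ : ∀ x a, 0 ≤ x → x < a → Λ x a = min (max (1 - x) 0) α) :
    γ < β / (1 + β) ∧
    ∀ x ≥ (0:ℝ), ∀ a ∈ Set.Icc γ 1, Λ x a ≤ Λ x (β / (1 + β)) := by
  obtain ⟨hα0, hα1⟩ := hα
  have hb0 : 0 < β / (1 + β) := by positivity
  have hlt := fun a => one_sub_mul_rpow_lt_s14 (a := a) hβ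
  set b := β / (1 + β)
  have hle : ∀ a, 0 < a → a ≤ 1 → (1 - a) * a ^ β ≤ (1 - b) * b ^ β := by
    intro a ha ha1
    rcases eq_or_ne a b with rfl | hne
    · exact le_rfl
    · exact (hlt a ha ha1 hne).le
  have hroot : α * (1 - α) ^ β < (1 - b) * b ^ β := by
    simpa using hlt (1 - α) (by linarith) (by linarith) h1.ne'
  have hroot0 : 0 < α * (1 - α) ^ β := mul_pos hα0 (Real.rpow_pos_of_pos (by linarith) _)
  have hγ0 : 0 < γ := by
    refine hγmem.1.lt_of_ne fun h => ?_
    rw [← h, Real.zero_rpow hβ.ne', mul_zero] at hγroot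
    exact hroot0.ne hγroot
  refine ⟨?_, ?_⟩
  · have hcont : ContinuousOn (fun a : ℝ => (1 - a) * a ^ β) (Set.Icc 0 b) :=
      ((continuous_const.sub continuous_id).mul
        (Real.continuous_rpow_const hβ.le)).continuousOn
    obtain ⟨a, ⟨ha0, hab⟩, ha⟩ := intermediate_value_Icc hb0.le hcont
      (show α * (1 - α) ^ β ∈ _ from
        ⟨by simpa [Real.zero_rpow hβ.ne'] using hroot0.le, hroot.le⟩)
    have hne : a ≠ b := by
      rintro rfl
      exact hroot.ne' ha
    exact (hγmin a ⟨ha0, by linarith⟩ ha).trans_lt (hab.lt_of_ne hne)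
  · rintro x hx a ⟨hγa, ha1⟩
    have ha0 : 0 < a := hγ0.trans_le hγa
    rcases lt_or_ge x b with hxb | hxb
    · have hαx : α ≤ max (1 - x) 0 := le_max_of_le_left (by linarith)
      rw [hΛ₂ x b hx hxb, min_eq_right hαx]
      rcases lt_or_ge x a with hxa | hxa
      · rw [hΛ₂ x a hx hxa]
        exact min_le_right _ _
      · rw [hΛ₁ x a ha0 hxa]
        linarith [min_le_right (1 - a) α, min_le_right ((1 - a) * (a / x) ^ β) α]
    · have hx0 : 0 < x := hb0.trans_le hxb
      have hscale : ∀ c, 0 < c → c ≤ 1 →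
          (1 - c) * (c / x) ^ β ≤ (1 - b) * (b / x) ^ β := by
        intro c hc hc1
        rw [Real.div_rpow hc.le hx0.le, Real.div_rpow hb0.le hx0.le, ← mul_div_assoc,
          ← mul_div_assoc]
        exact div_le_div_of_nonneg_right (hle c hc hc1) (by positivity)
      rw [hΛ₁ x b hb0 hxb, min_eq_right (show α ≤ 1 - b by linarith)]
      rcases lt_or_ge x a with hxa | hxa
      · have h := hscale x hx0 (by linarith)
        rw [div_self hx0.ne', Real.one_rpow, mul_one] at h
        rw [hΛ₂ x a hx hxa, max_eq_left (by linarith)]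
        linarith [min_le_right (1 - x) α, min_le_min_right α h]
      · rw [hΛ₁ x a ha0 hxa]
        linarith [min_le_right (1 - a) α, min_le_min_right α (hscale a ha0 ha1)]
end

section
/- Let γ := (1+√13)/8. For x ≥ a > 0 define Λ(x,a) := (1/2)·min{(1−a)·(a/x), 1/4} + (1/2)·min{(1−a)·(a/x)², 1/4}, and for 0 ≤ x < a define Λ(x,a) := min{(1−x)⁺, 1/4}. Then there is no a₀ ∈ [γ, 1] such that Λ(x, a₀) ≥ Λ(x, a) for all x > 0 and all a ∈ [γ, 1]. In particular, one may verify Λ(x, 2/3) > Λ(x, γ) for x ∈ (4√3/9, 8/9) while Λ(x, γ) > Λ(x, 2/3) for all sufficiently large x. -/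
theorem stmt_17 (γ : ℝ) (hγ : γ = (1 + Real.sqrt 13) / 8)
    (Λ : ℝ → ℝ → ℝ)
    (hΛ₁ : ∀ x a, 0 < a → a ≤ x →
      Λ x a = (1 / 2) * min ((1 - a) * (a / x)) (1 / 4)
            + (1 / 2) * min ((1 - a) * (a / x) ^ 2) (1 / 4))
    (hΛ₂ : ∀ x a, 0 ≤ x → x < a → Λ x a = min (max (1 - x) 0) (1 / 4)) :
    (¬ ∃ a₀ ∈ Set.Icc γ 1, ∀ x > (0:ℝ), ∀ a ∈ Set.Icc γ 1, Λ x a ≤ Λ x a₀) ∧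
    (∀ x ∈ Set.Ioo (4 * Real.sqrt 3 / 9) (8 / 9 : ℝ), Λ x (2 / 3) > Λ x γ) ∧
    (∃ X : ℝ, ∀ x ≥ X, Λ x γ > Λ x (2 / 3)) := by
  have hsq : 16 * γ ^ 2 = 4 * γ + 3 := by
    have h13 : Real.sqrt 13 ^ 2 = 13 := Real.sq_sqrt (by norm_num)
    rw [hγ]
    linear_combination (1 / 4) * h13
  have hγlo : 23 / 40 < γ := by
    have : (18 / 5 : ℝ) < Real.sqrt 13 := Real.lt_sqrt_of_sq_lt (by norm_num)
    rw [hγ]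
    linarith
  have hγhi : γ < 5767 / 10000 := by
    nlinarith
  have hcube : (1 - γ) * γ ^ 2 = 9 / 64 := by
    linear_combination (1 / 16 * (3 / 4 - γ)) * hsq
  have hΛ_large : ∀ a x, 0 < a → a ≤ 1 → 1 ≤ x →
      x ^ 2 * Λ x a = 1 / 2 * ((1 - a) * a * x) + 1 / 2 * ((1 - a) * a ^ 2) := by
    intro a x ha ha1 hx
    have hx0 : 0 < x := by linarith
    have hax : 0 < a / x := div_pos ha hx0
    have haxa : a / x ≤ a := div_le_self ha.le hx
    have h1 : (1 - a) * (a / x) ≤ 1 / 4 := by nlinarith [sq_nonneg (a - 1 / 2)]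
    have h2 : (1 - a) * (a / x) ^ 2 ≤ 1 / 4 := by
      have hsmall : (a / x) ^ 2 ≤ a / x := by nlinarith
      nlinarith
    rw [hΛ₁ x a ha (by linarith), min_eq_left h1, min_eq_left h2]
    field_simp
  have hmid : ∀ x ∈ Set.Ioo (4 * Real.sqrt 3 / 9) (8 / 9 : ℝ), Λ x (2 / 3) > Λ x γ := by
    rintro x ⟨hxl, hxu⟩
    have hs : Real.sqrt 3 ^ 2 = 3 := Real.sq_sqrt (by norm_num)
    have hs1 : (17 / 10 : ℝ) < Real.sqrt 3 := Real.lt_sqrt_of_sq_lt (by norm_num)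
    have hx34 : 3 / 4 < x := by linarith
    have hx0 : 0 < x := by linarith
    have hx2 : 16 / 27 < x ^ 2 := by nlinarith
    rw [hΛ₁ x (2 / 3) (by norm_num) (by linarith), hΛ₁ x γ (by linarith) (by linarith)]
    have h1 : 1 / 4 ≤ (1 - 2 / 3) * (2 / 3 / x) := by
      rw [← mul_div_assoc, le_div_iff₀ hx0]
      linarith
    have h2 : (1 - 2 / 3) * (2 / 3 / x) ^ 2 ≤ 1 / 4 := by
      rw [div_pow, ← mul_div_assoc, div_le_iff₀ (by positivity)]
      linarith
    have h3 : (1 - γ) * (γ / x) ^ 2 < (1 - 2 / 3) * (2 / 3 / x) ^ 2 := by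
      rw [div_pow, div_pow, ← mul_div_assoc, ← mul_div_assoc, hcube]
      gcongr
      norm_num
    rw [min_eq_right h1, min_eq_left h2]
    linarith [min_le_right ((1 - γ) * (γ / x)) (1 / 4), min_le_left ((1 - γ) * (γ / x) ^ 2) (1 / 4)]
  refine ⟨?_, hmid, 1, ?_⟩
  · rintro ⟨a₀, ⟨hlo, hhi⟩, hopt⟩
    rcases hlo.eq_or_lt with rfl | hlt
    · have hs : Real.sqrt 3 < 9 / 5 := by
        rw [Real.sqrt_lt' (by norm_num)]
        norm_num
      have hbad := hmid (4 / 5) ⟨by linarith, by norm_num⟩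
      linarith [hopt (4 / 5) (by norm_num) (2 / 3) ⟨by linarith, by norm_num⟩]
    · obtain ⟨c, hc⟩ : ∃ c, c = (1 - γ) * γ - (1 - a₀) * a₀ := ⟨_, rfl⟩
      have hc0 : 0 < c := by nlinarith
      have hx1 : 1 ≤ 1 + 1 / c := by linarith [one_div_pos.mpr hc0]
      have hle := mul_le_mul_of_nonneg_left
        (hopt (1 + 1 / c) (by linarith) γ ⟨le_rfl, by linarith⟩) (sq_nonneg (1 + 1 / c))
      rw [hΛ_large γ _ (by linarith) (by linarith) hx1,
        hΛ_large a₀ _ (by linarith) hhi hx1, hcube] at hle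
      have hcx : c * (1 + 1 / c) = c + 1 := by field_simp
      have hd : (1 - a₀) * a₀ ^ 2 ≤ 1 := by
        nlinarith [pow_le_one₀ (n := 2) (by linarith : 0 ≤ a₀) hhi, sq_nonneg a₀]
      rw [hc] at hcx hc0 hle
      linarith
  · intro x hx
    have hγx := hΛ_large γ x (by linarith) (by linarith) hx
    have h23 := hΛ_large (2 / 3) x (by norm_num) (by norm_num) hx
    rw [hcube] at hγx
    have hprod : 2 / 9 + 1 / 50 ≤ (1 - γ) * γ := by linarith
    refine lt_of_mul_lt_mul_left ?_ (sq_nonneg x)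
    nlinarith
end

section
/- Let γ be the unique solution in (0, 4/5) of (1−γ)·γ·e^{2√2·γ} = (4/25)·e^{(8√2)/5}. For x ≥ a > 0 define Λ(x,a) := (1/2)·min{(1−a)·(a/x), 1/5} + (1/2)·min{(1−a)·(a/x)·e^{−2√2(x−a)}, 1/5}, and for 0 ≤ x < a define Λ(x,a) := min{(1−x)⁺, 1/5}. Then there is no a₀ ∈ [γ, 1] such that Λ(x, a₀) ≥ Λ(x, a) for all x > 0 and all a ∈ [γ, 1]. -/
theorem exp_barrier_lt_half :
    (1 - 1 / 2) * (1 / 2) * Real.exp (2 * Real.sqrt 2 * (1 / 2))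
      < (4 / 25) * Real.exp (8 * Real.sqrt 2 / 5) := by
  have hs : (1.4 : ℝ) ≤ Real.sqrt 2 := Real.le_sqrt_of_sq_le (by norm_num)
  have hsplit : Real.exp (8 * Real.sqrt 2 / 5)
      = Real.exp (2 * Real.sqrt 2 * (1 / 2)) * Real.exp (3 * Real.sqrt 2 / 5) := by
    rw [← Real.exp_add]
    ring_nf
  have hexp := Real.add_one_le_exp (3 * Real.sqrt 2 / 5)
  have hpos := Real.exp_pos (2 * Real.sqrt 2 * (1 / 2))
  rw [hsplit]
  nlinarith

theorem exp_barrier_three_quarters_gt :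
    (4 / 25) * Real.exp (8 * Real.sqrt 2 / 5)
      < (1 - 3 / 4) * (3 / 4) * Real.exp (2 * Real.sqrt 2 * (3 / 4)) := by
  have hs : Real.sqrt 2 ≤ 1.42 := Real.sqrt_le_iff.2 (by norm_num)
  have hsplit : Real.exp (2 * Real.sqrt 2 * (3 / 4))
      = Real.exp (8 * Real.sqrt 2 / 5) * Real.exp (-(Real.sqrt 2 / 10)) := by
    rw [← Real.exp_add]
    ring_nf
  have hexp := Real.add_one_le_exp (-(Real.sqrt 2 / 10))
  have hpos := Real.exp_pos (8 * Real.sqrt 2 / 5)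
  rw [hsplit]
  nlinarith

theorem exists_exp_barrier_root :
    ∃ a ∈ Set.Ioo (1 / 2 : ℝ) (3 / 4),
      (1 - a) * a * Real.exp (2 * Real.sqrt 2 * a)
        = (4 / 25) * Real.exp (8 * Real.sqrt 2 / 5) := by
  have hcont : ContinuousOn (fun a : ℝ => (1 - a) * a * Real.exp (2 * Real.sqrt 2 * a))
      (Set.Icc (1 / 2) (3 / 4)) := by fun_prop
  exact intermediate_value_Ioo (by norm_num) hcont
    ⟨exp_barrier_lt_half, exp_barrier_three_quarters_gt⟩

theorem stmt_18 (γ : ℝ) (hγmem : γ ∈ Set.Ioo (0:ℝ) (4 / 5))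
    (hγroot : (1 - γ) * γ * Real.exp (2 * Real.sqrt 2 * γ)
      = (4 / 25) * Real.exp (8 * Real.sqrt 2 / 5))
    (hγuniq : ∀ a ∈ Set.Ioo (0:ℝ) (4 / 5),
      (1 - a) * a * Real.exp (2 * Real.sqrt 2 * a) = (4 / 25) * Real.exp (8 * Real.sqrt 2 / 5) →
      a = γ)
    (Λ : ℝ → ℝ → ℝ)
    (hΛ₁ : ∀ x a, 0 < a → a ≤ x →
      Λ x a = (1 / 2) * min ((1 - a) * (a / x)) (1 / 5)
            + (1 / 2) * min ((1 - a) * (a / x) * Real.exp (-2 * Real.sqrt 2 * (x - a))) (1 / 5))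
    (hΛ₂ : ∀ x a, 0 ≤ x → x < a → Λ x a = min (max (1 - x) 0) (1 / 5)) :
    ¬ ∃ a₀ ∈ Set.Icc γ 1, ∀ x > (0:ℝ), ∀ a ∈ Set.Icc γ 1, Λ x a ≤ Λ x a₀ := by
  obtain ⟨b, hb, hbroot⟩ := exists_exp_barrier_root
  obtain rfl : b = γ := hγuniq b ⟨by linarith [hb.1], by linarith [hb.2]⟩ hbroot
  obtain ⟨hb₁, hb₂⟩ := hb
  rintro ⟨a₀, ⟨ha₀b, ha₀⟩, hopt⟩
  have hs : (1 : ℝ) ≤ Real.sqrt 2 := Real.le_sqrt_of_sq_le (by norm_num)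
  rcases ha₀b.eq_or_lt with rfl | hlt
  · have key := hopt (17 / 20) (by norm_num) (3 / 4) ⟨hb₂.le, by norm_num⟩
    rw [hΛ₁ _ _ (by norm_num) (by norm_num), hΛ₁ _ _ (by linarith) (by linarith)] at key
    have hcap : min ((1 - (3 / 4 : ℝ)) * (3 / 4 / (17 / 20))) (1 / 5) = 1 / 5 :=
      min_eq_right (by norm_num)
    have hscale (a : ℝ) : (1 - a) * (a / (17 / 20))
          * Real.exp (-2 * Real.sqrt 2 * (17 / 20 - a))
        = (1 - a) * a * Real.exp (2 * Real.sqrt 2 * a)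
          * (20 / 17 * Real.exp (-(17 * Real.sqrt 2 / 10))) := by
      rw [show -2 * Real.sqrt 2 * (17 / 20 - a)
        = 2 * Real.sqrt 2 * a + -(17 * Real.sqrt 2 / 10) by ring, Real.exp_add]
      ring
    have hdisc : (4 / 25) * Real.exp (8 * Real.sqrt 2 / 5)
        * (20 / 17 * Real.exp (-(17 * Real.sqrt 2 / 10))) < 1 / 5 := by
      have hle : Real.exp (8 * Real.sqrt 2 / 5) * Real.exp (-(17 * Real.sqrt 2 / 10)) ≤ 1 := by
        rw [← Real.exp_add]
        exact Real.exp_le_one_iff.2 (by linarith)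
      linarith
    have hgt := mul_lt_mul_of_pos_right exp_barrier_three_quarters_gt
      (show 0 < 20 / 17 * Real.exp (-(17 * Real.sqrt 2 / 10)) by positivity)
    rw [hcap, hscale, hscale, hbroot, min_eq_left hdisc.le] at key
    have hmin := lt_min hgt hdisc
    have := min_le_right ((1 - b) * (b / (17 / 20))) (1 / 5)
    linarith
  · have hD : 0 < b * (1 - b) - a₀ * (1 - a₀) := by nlinarith
    set D := b * (1 - b) - a₀ * (1 - a₀) with hDdef
    have hDinv : 0 < 1 / D := by positivity
    set x := 5 / 4 + 1 / D with hx
    have hx0 : 0 < x := by positivity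
    have key := hopt x hx0 b ⟨le_rfl, by linarith⟩
    rw [hΛ₁ _ _ (by linarith) (by linarith), hΛ₁ _ _ (by linarith) (by linarith)] at key
    have hunc : min ((1 - b) * (b / x)) (1 / 5) = (1 - b) * (b / x) := by
      apply min_eq_left
      rw [mul_div_assoc', div_le_iff₀ hx0]
      nlinarith [sq_nonneg (b - 1 / 2)]
    have hnonneg : 0 ≤ min ((1 - b) * (b / x) * Real.exp (-2 * Real.sqrt 2 * (x - b))) (1 / 5) := by
      have : 0 < 1 - b := by linarith
      have : 0 < b := by linarith
      positivity
    have hexp : Real.exp (-2 * Real.sqrt 2 * (x - a₀)) < D := by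
      have hle : Real.exp (-2 * Real.sqrt 2 * (x - a₀)) ≤ Real.exp (-(1 / D)) :=
        Real.exp_le_exp.2 (by nlinarith)
      refine hle.trans_lt ?_
      rw [Real.exp_neg]
      refine inv_lt_of_inv_lt₀ hD ?_
      rw [← one_div]
      linarith [Real.add_one_le_exp (1 / D)]
    have h₁ := min_le_left ((1 - a₀) * (a₀ / x)) (1 / 5)
    have h₂ := min_le_left ((1 - a₀) * (a₀ / x) * Real.exp (-2 * Real.sqrt 2 * (x - a₀))) (1 / 5)
    have hle : (1 - b) * (b / x)
        ≤ (1 - a₀) * (a₀ / x) + (1 - a₀) * (a₀ / x) * Real.exp (-2 * Real.sqrt 2 * (x - a₀)) := by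
      linarith
    have hmul := mul_le_mul_of_nonneg_right hle hx0.le
    have hclear : ∀ a : ℝ, a / x * x = a := fun a => div_mul_cancel₀ a hx0.ne'
    have hcleared : D ≤ (1 - a₀) * a₀ * Real.exp (-2 * Real.sqrt 2 * (x - a₀)) := by
      linear_combination hmul - (1 - b) * hclear b
        + (1 - a₀) * (1 + Real.exp (-2 * Real.sqrt 2 * (x - a₀))) * hclear a₀
    have hbound : (1 - a₀) * a₀ ≤ 1 := by nlinarith
    have := mul_le_mul_of_nonneg_right hbound (Real.exp_pos (-2 * Real.sqrt 2 * (x - a₀))).le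
    linarith
end
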